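/- Let H be a graph with disjoint distinguished ordered tuples of vertices U = (u_1,…,u_x) and V = (v_1,…,v_y) and remaining vertices W = (w_1,…,w_z), each of degree at least one, with t = |V(H)| = x + y + z, and let q be the minimum size of a vertex separator of U and V in H. Let V_1,…,V_t be a partition of {1,…,n} and let R' be the matrix with rows indexed by x-element subsets A = {a_1 < … < a_x} and columns indexed by y-element subsets B = {b_1 < … < b_y} of {1,…,n}, where R'(A,B) = Σ_{C : c_k ∈ V_{x+y+k} for all k} χ_{π(E(H))}(g) if A ∩ B = ∅, a_i ∈ V_i for all i, and b_j ∈ V_{x+j} for all j (the sum over ordered tuples C = (c_1,…,c_z) of distinct elements of {1,…,n} \ (A ∪ B) with c_k ∈ V_{x+y+k}, and π maps u_i ↦ a_i, v_j ↦ b_j, w_k ↦ c_k), and R'(A,B) = 0 otherwise. Then for every integer k ≥ 1, E[tr((R'·R'ᵀ)^k)] ≤ ((t+z)·k)^{2k(z+q)−2q}·n^{(t−q)k+q}. -/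

import Mathlib

def sgn (b : Bool) : ℝ := if b then 1 else -1

noncomputable def Pr {n : ℕ} (P : (Sym2 (Fin n) → Bool) → Prop) : ℝ := by
  classical
  exact ((Finset.univ.filter P).card : ℝ) / (Fintype.card (Sym2 (Fin n) → Bool))

noncomputable def Ex {n : ℕ} (f : (Sym2 (Fin n) → Bool) → ℝ) : ℝ :=
  (∑ g : Sym2 (Fin n) → Bool, f g) / (Fintype.card (Sym2 (Fin n) → Bool))

noncomputable def Rmat {n : ℕ} (g : Sym2 (Fin n) → Bool) : Matrix (Fin n) (Fin n) ℝ :=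
  Matrix.of fun i j => if i = j then 0 else sgn (g s(i, j))

def cyc {m : ℕ} (j : Fin m) : Fin m := ⟨((j : ℕ) + 1) % m, Nat.mod_lt _ j.pos⟩

abbrev SubsetsCard (n x : ℕ) := {A : Finset (Fin n) // A.card = x}

def tup {n x : ℕ} (A : SubsetsCard n x) (i : Fin x) : Fin n :=
  (A.1.orderIsoOfFin A.2 i : Fin n)

noncomputable def RH {n x y : ℕ} (E : Finset (Fin x × Fin y)) (g : Sym2 (Fin n) → Bool) :
    Matrix (SubsetsCard n x) (SubsetsCard n y) ℝ :=
  Matrix.of fun A B =>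
    if Disjoint A.1 B.1 then ∏ e ∈ E, sgn (g s(tup A e.1, tup B e.2)) else 0

def IsVertexCover {x y : ℕ} (E : Finset (Fin x × Fin y)) (S : Finset (Fin x ⊕ Fin y)) : Prop :=
  ∀ e ∈ E, Sum.inl e.1 ∈ S ∨ Sum.inr e.2 ∈ S

def IsSep {x y z : ℕ} (H : SimpleGraph (Fin x ⊕ Fin y ⊕ Fin z))
    (S : Finset (Fin x ⊕ Fin y ⊕ Fin z)) : Prop :=
  ∀ (i : Fin x) (j : Fin y) (p : H.Walk (Sum.inl i) (Sum.inr (Sum.inl j))),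
    ∃ s ∈ S, s ∈ p.support

noncomputable def RHgenPart {n x y z : ℕ} (H : SimpleGraph (Fin x ⊕ Fin y ⊕ Fin z))
    [DecidableRel H.Adj] (P : (Fin x ⊕ Fin y ⊕ Fin z) → Finset (Fin n))
    (g : Sym2 (Fin n) → Bool) :
    Matrix (SubsetsCard n x) (SubsetsCard n y) ℝ :=
  Matrix.of fun A B =>
    if Disjoint A.1 B.1 ∧ (∀ i, tup A i ∈ P (Sum.inl i)) ∧
        (∀ j, tup B j ∈ P (Sum.inr (Sum.inl j))) then
      ∑ C : Fin z ↪ Fin n,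
        if (∀ m, C m ∉ A.1 ∧ C m ∉ B.1) ∧ (∀ m, C m ∈ P (Sum.inr (Sum.inr m))) then
          ∏ e ∈ H.edgeFinset,
            sgn (g (Sym2.map (Sum.elim (tup A) (Sum.elim (tup B) ⇑C)) e))
        else 0
    else 0

section

open Finset

section Encoding

/-- Functions with few values are determined by their values at few positions, together with a
rule copying the remaining values. -/
theorem card_le_of_card_image_le {ι κ : Type*} [Fintype ι] [DecidableEq ι] [Fintype κ]
    [DecidableEq κ] (S : Finset (ι → κ)) (d m : ℕ) (hN : Fintype.card ι = d + m)
    (hS : ∀ f ∈ S, (univ.image f).card ≤ d) :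
    S.card ≤ Fintype.card ι ^ (2 * m) * Fintype.card κ ^ d := by
  classical
  let I : Finset ((Fin m → ι) × (Fin m → ι)) :=
    univ.filter fun c => Function.Injective c.1 ∧ ∀ i j, c.2 i ≠ c.1 j
  let F : (Fin m → ι) × (Fin m → ι) → Finset (ι → κ) := fun c =>
    univ.filter fun f => ∀ i, f (c.1 i) = f (c.2 i)
  have hsub : S ⊆ I.biUnion F := by
    intro f hf
    have hrep : ∀ b ∈ univ.image f, ∃ a, f a = b := by
      intro b hb
      obtain ⟨a, -, ha⟩ := mem_image.1 hb
      exact ⟨a, ha⟩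
    choose rep hrep using hrep
    have hmem : ∀ p, f p ∈ univ.image f := fun p => mem_image_of_mem _ (mem_univ _)
    let T := (univ.image f).attach.image fun b => rep b.1 b.2
    have hT : T.card ≤ d := card_image_le.trans (card_attach.trans_le (hS f hf))
    have hd : d ≤ (univ : Finset ι).card := by rw [card_univ]; omega
    obtain ⟨T', hTT', -, hT'⟩ := exists_subsuperset_card_eq (subset_univ T) hT hd
    have hc : T'ᶜ.card = m := by rw [card_compl]; omega
    let e := T'ᶜ.equivFinOfCardEq hc
    refine mem_biUnion.2 ⟨(fun i => (e.symm i : ι), fun i => rep _ (hmem (e.symm i))), ?_, ?_⟩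
    · simp only [I, mem_filter, mem_univ, true_and]
      refine ⟨Subtype.val_injective.comp e.symm.injective, fun i j h => ?_⟩
      have h1 : rep _ (hmem (e.symm i)) ∈ T' :=
        hTT' (mem_image.2 ⟨⟨_, hmem (e.symm i)⟩, mem_attach _ _, rfl⟩)
      exact (mem_compl.1 (e.symm j).2) (h ▸ h1)
    · simp only [F, mem_filter, mem_univ, true_and]
      intro i
      exact (hrep _ (hmem _)).symm
  have hF : ∀ c ∈ I, (F c).card ≤ Fintype.card κ ^ d := by
    intro c hc
    simp only [I, mem_filter, mem_univ, true_and] at hc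
    let Q := (univ.image c.1)ᶜ
    have hQ : Q.card = d := by
      rw [card_compl, card_image_of_injective _ hc.1]; simp; omega
    have : (F c).card ≤ (univ : Finset (Q → κ)).card := by
      refine card_le_card_of_injOn (fun f p => f p) (fun _ _ => mem_coe.2 (mem_univ _)) ?_
      intro f hf f' hf' h
      simp only [F, coe_filter, mem_univ, true_and, Set.mem_ofPred_eq] at hf hf'
      have hag : ∀ p ∈ Q, f p = f' p := fun p hp => congrFun h ⟨p, hp⟩
      funext p
      by_cases hp : p ∈ Q
      · exact hag p hp
      · simp only [Q, mem_compl, not_not, mem_image, mem_univ, true_and] at hp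
        obtain ⟨i, rfl⟩ := hp
        rw [hf, hf']
        apply hag
        simp only [Q, mem_compl, mem_image, mem_univ, true_and, not_exists]
        exact fun j hj => hc.2 i j hj.symm
    rw [card_univ, Fintype.card_fun, Fintype.card_coe, hQ] at this
    exact this
  calc S.card ≤ (I.biUnion F).card := card_le_card hsub
    _ ≤ I.card * Fintype.card κ ^ d := card_biUnion_le_card_mul _ _ _ hF
    _ ≤ _ := by
      gcongr
      refine (card_le_univ _).trans ?_
      simp only [Fintype.card_prod, Fintype.card_fun, Fintype.card_fin]
      rw [two_mul, pow_add]

end Encoding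

section Trace

theorem Matrix.pow_succ_apply_eq_sum {ι R : Type*} [Fintype ι] [DecidableEq ι] [CommSemiring R]
    (M : Matrix ι ι R) (k : ℕ) (a b : ι) :
    (M ^ (k + 1)) a b = ∑ f : Fin k → ι, ∏ i : Fin (k + 1),
      M ((Fin.cons a f : Fin (k + 1) → ι) i) ((Fin.snoc f b : Fin (k + 1) → ι) i) := by
  induction k generalizing a with
  | zero => simp [Fin.snoc]
  | succ k ih =>
    rw [pow_succ', Matrix.mul_apply, ← (Fin.consEquiv fun _ : Fin (k + 1) => ι).sum_comp,
      Fintype.sum_prod_type]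
    refine sum_congr rfl fun c _ => ?_
    rw [ih, mul_sum]
    refine sum_congr rfl fun f _ => ?_
    conv_rhs => rw [Fin.prod_univ_succ]
    simp [Fin.consEquiv, ← Fin.cons_snoc_eq_snoc_cons]

theorem Matrix.trace_pow_succ_eq_sum {ι R : Type*} [Fintype ι] [DecidableEq ι] [CommSemiring R]
    (M : Matrix ι ι R) (k : ℕ) :
    (M ^ (k + 1)).trace = ∑ f : Fin (k + 1) → ι, ∏ i, M (f i) (f (i + 1)) := by
  rw [← (Fin.consEquiv fun _ : Fin (k + 1) => ι).sum_comp, Fintype.sum_prod_type]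
  refine sum_congr rfl fun a _ => ?_
  rw [Matrix.diag_apply, Matrix.pow_succ_apply_eq_sum]
  refine sum_congr rfl fun f _ => prod_congr rfl fun i _ => ?_
  congr 1
  refine Fin.lastCases ?_ (fun j => ?_) i
  · simp [Fin.consEquiv]
  · simp [Fin.consEquiv]

end Trace

section Distinct

theorem SimpleGraph.Walk.exists_mem_support_inter {V : Type*} {G : SimpleGraph V} {L R : Set V}
    (hadj : ∀ a b, G.Adj a b → (a ∈ L ∧ b ∈ L) ∨ (a ∈ R ∧ b ∈ R)) {a b : V} (p : G.Walk a b)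
    (ha : a ∈ L) (hb : b ∈ R) : ∃ s ∈ p.support, s ∈ L ∧ s ∈ R := by
  induction p with
  | nil => exact ⟨_, by simp, ha, hb⟩
  | cons h p ih =>
    rcases hadj _ _ h with h' | h'
    · obtain ⟨s, hs, hs'⟩ := ih h'.2 hb
      exact ⟨s, by simp [hs], hs'⟩
    · exact ⟨_, by simp, ha, h'.1⟩

variable {n x y z : ℕ}

/-- Every copy of every edge is repeated in another of the first `K` copies. -/
def EdgesRepeat (H : SimpleGraph (Fin x ⊕ Fin y ⊕ Fin z)) (K : ℕ)
    (φ : ℕ → (Fin x ⊕ Fin y ⊕ Fin z) → Fin n) : Prop :=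
  ∀ s < K, ∀ a b, H.Adj a b → ∃ s' < K, s' ≠ s ∧ φ s' a = φ s a ∧ φ s' b = φ s b

theorem card_image_le_card_first {V κ : Type*} [Fintype V] [DecidableEq V] [DecidableEq κ]
    (K : ℕ) (φ : ℕ → V → κ) :
    ((range K ×ˢ (univ : Finset V)).image fun p => φ p.1 p.2).card ≤
      ∑ s ∈ range K, (univ.filter fun a => ∀ s' < s, φ s' a ≠ φ s a).card := by
  rw [← card_sigma]
  refine (card_le_card (t := Finset.image (fun p : (_ : ℕ) × V => φ p.1 p.2) _) ?_).trans
    card_image_le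
  intro b hb
  simp only [mem_image, mem_product, mem_range, mem_univ, and_true, Prod.exists] at hb
  obtain ⟨s, a, hs, rfl⟩ := hb
  have hex : ∃ s', φ s' a = φ s a := ⟨s, rfl⟩
  classical
  have hle : Nat.find hex ≤ s := Nat.find_min' hex rfl
  refine mem_image.2 ⟨⟨Nat.find hex, a⟩, ?_, Nat.find_spec hex⟩
  simp only [mem_sigma, mem_range, mem_filter, mem_univ, true_and]
  refine ⟨by omega, fun s' hs' h => ?_⟩
  exact Nat.find_min hex hs' (h.trans (Nat.find_spec hex))

theorem card_image_le_card_last {V κ : Type*} [Fintype V] [DecidableEq V] [DecidableEq κ]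
    (K : ℕ) (φ : ℕ → V → κ) :
    ((range K ×ˢ (univ : Finset V)).image fun p => φ p.1 p.2).card ≤
      ∑ s ∈ range K, (univ.filter fun a => ∀ s' < K, s < s' → φ s' a ≠ φ s a).card := by
  have h := card_image_le_card_first K fun s => φ (K - 1 - s)
  rw [← sum_range_reflect] at h
  have himg : ((range K ×ˢ (univ : Finset V)).image fun p => φ (K - 1 - p.1) p.2) =
      (range K ×ˢ (univ : Finset V)).image fun p => φ p.1 p.2 := by
    ext b
    simp only [mem_image, mem_product, mem_range, mem_univ, and_true, Prod.exists]
    constructor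
    · rintro ⟨s, a, hs, rfl⟩
      exact ⟨K - 1 - s, a, by omega, rfl⟩
    · rintro ⟨s, a, hs, rfl⟩
      exact ⟨K - 1 - s, a, by omega, by rw [show K - 1 - (K - 1 - s) = s by omega]⟩
  rw [himg] at h
  refine h.trans (sum_le_sum fun s hs => card_le_card fun a ha => ?_)
  simp only [mem_filter, mem_univ, true_and, mem_range] at ha hs ⊢
  intro s' hs' hlt
  have := ha (K - 1 - s') (by omega)
  rwa [show K - 1 - (K - 1 - s') = s' by omega, show K - 1 - (K - 1 - s) = s by omega] at this

theorem card_image_le_of_edgesRepeat {q : ℕ} (k : ℕ) (H : SimpleGraph (Fin x ⊕ Fin y ⊕ Fin z))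
    [DecidableRel H.Adj] (hdeg : ∀ m : Fin z, 0 < H.degree (Sum.inr (Sum.inr m)))
    (hq : ∀ S, IsSep H S → q ≤ S.card) (φ : ℕ → (Fin x ⊕ Fin y ⊕ Fin z) → Fin n)
    (hφ : EdgesRepeat H (2 * (k + 1)) φ)
    (hV : ∀ i ≤ k, ∀ j, φ (2 * i + 1) (Sum.inr (Sum.inl j)) = φ (2 * i) (Sum.inr (Sum.inl j)))
    (hU : ∀ i < k, ∀ j, φ (2 * i + 2) (Sum.inl j) = φ (2 * i + 1) (Sum.inl j))
    (hU' : ∀ j, φ (2 * k + 1) (Sum.inl j) = φ 0 (Sum.inl j)) :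
    ((range (2 * (k + 1)) ×ˢ (univ : Finset (Fin x ⊕ Fin y ⊕ Fin z))).image
      fun p => φ p.1 p.2).card ≤ (x + y + z - q) * k + (x + y + z) := by
  classical
  set K := 2 * (k + 1) with hK
  have hrep : ∀ s < K, ∀ a, ∃ s' < K, s' ≠ s ∧ φ s' a = φ s a := by
    intro s hs a
    rcases a with i | j | m
    · rcases Nat.even_or_odd' s with ⟨r, rfl | rfl⟩
      · rcases r with _ | r
        · exact ⟨2 * k + 1, by omega, by omega, hU' i⟩
        · exact ⟨2 * r + 1, by omega, by omega, (hU r (by omega) i).symm⟩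
      · by_cases hr : r < k
        · exact ⟨2 * r + 2, by omega, by omega, hU r hr i⟩
        · obtain rfl : r = k := by omega
          exact ⟨0, by omega, by omega, (hU' i).symm⟩
    · rcases Nat.even_or_odd' s with ⟨r, rfl | rfl⟩
      · exact ⟨2 * r + 1, by omega, by omega, hV r (by omega) j⟩
      · exact ⟨2 * r, by omega, by omega, (hV r (by omega) j).symm⟩
    · obtain ⟨b, hb⟩ := (H.degree_pos_iff_exists_adj _).1 (hdeg m)
      obtain ⟨s', h1, h2, h3, -⟩ := hφ s hs _ _ hb
      exact ⟨s', h1, h2, h3⟩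
  let f : ℕ → Finset (Fin x ⊕ Fin y ⊕ Fin z) := fun s =>
    univ.filter fun a => ∀ s' < s, φ s' a ≠ φ s a
  let l : ℕ → Finset (Fin x ⊕ Fin y ⊕ Fin z) := fun s =>
    univ.filter fun a => ∀ s' < K, s < s' → φ s' a ≠ φ s a
  have hcard : Fintype.card (Fin x ⊕ Fin y ⊕ Fin z) = x + y + z := by simp; ring
  have hdisj : ∀ s < K, Disjoint (f s) (l s) := by
    intro s hs
    rw [disjoint_left]
    intro a ha hb
    simp only [f, l, mem_filter, mem_univ, true_and] at ha hb
    obtain ⟨s', h1, h2, h3⟩ := hrep s hs a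
    rcases lt_or_gt_of_ne h2 with h | h
    · exact ha s' h h3
    · exact hb s' h1 h h3
  have hle : ∀ s < K, (f s).card + (l s).card ≤ x + y + z := by
    intro s hs
    rw [← card_union_of_disjoint (hdisj s hs), ← hcard]
    exact card_le_univ _
  have hsep : ∀ s, 0 < s → s + 1 < K → (f s).card + (l s).card ≤ x + y + z - q := by
    intro s hs0 hsK
    have : IsSep H (f s ∪ l s)ᶜ := by
      intro i j p
      let L : Set (Fin x ⊕ Fin y ⊕ Fin z) := {a | ∃ s' < s, φ s' a = φ s a}
      let R : Set (Fin x ⊕ Fin y ⊕ Fin z) := {a | ∃ s' < K, s < s' ∧ φ s' a = φ s a}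
      have hadj : ∀ a b, H.Adj a b → (a ∈ L ∧ b ∈ L) ∨ (a ∈ R ∧ b ∈ R) := by
        intro a b hab
        obtain ⟨s', h1, h2, h3, h4⟩ := hφ s (by omega) a b hab
        rcases lt_or_gt_of_ne h2 with h | h
        · exact Or.inl ⟨⟨s', h, h3⟩, ⟨s', h, h4⟩⟩
        · exact Or.inr ⟨⟨s', h1, h, h3⟩, ⟨s', h1, h, h4⟩⟩
      have key : ∃ c ∈ p.support, c ∈ L ∧ c ∈ R := by
        rcases Nat.even_or_odd' s with ⟨r, hr | hr⟩
        · refine p.exists_mem_support_inter hadj ⟨2 * (r - 1) + 1, by omega, ?_⟩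
            ⟨2 * r + 1, by omega, by omega, ?_⟩
          · rw [← hU (r - 1) (by omega) i]
            congr 1; omega
          · rw [hr]; exact hV r (by omega) j
        · obtain ⟨c, h1, h2, h3⟩ := p.exists_mem_support_inter
            (fun a b h => (hadj a b h).symm) (L := R) (R := L)
            ⟨2 * r + 2, by omega, by omega, by rw [hr]; exact hU r (by omega) i⟩
            ⟨2 * r, by omega, by rw [hr]; exact (hV r (by omega) j).symm⟩
          exact ⟨c, h1, h3, h2⟩
      obtain ⟨c, hc, ⟨s₁, h1, h2⟩, ⟨s₂, h3, h4, h5⟩⟩ := key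
      refine ⟨c, ?_, hc⟩
      simp only [f, l, mem_compl, mem_union, mem_filter, mem_univ, true_and, not_or]
      exact ⟨fun h => h s₁ h1 h2, fun h => h s₂ h3 h4 h5⟩
    have := hq _ this
    rw [card_compl, hcard, card_union_of_disjoint (hdisj s (by omega))] at this
    have := hle s (by omega)
    omega
  have h1 := card_image_le_card_first K φ
  have h2 := card_image_le_card_last K φ
  have h3 : ∑ s ∈ range K, ((f s).card + (l s).card) ≤
      2 * ((x + y + z - q) * k + (x + y + z)) := by
    rw [hK, show 2 * (k + 1) = 2 * k + 1 + 1 by ring, sum_range_succ, sum_range_succ']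
    have ha := hle 0 (by omega)
    have hb := hle (2 * k + 1) (by omega)
    have hc : ∑ s ∈ range (2 * k), ((f (s + 1)).card + (l (s + 1)).card) ≤
        2 * k * (x + y + z - q) := by
      refine (sum_le_card_nsmul _ _ (x + y + z - q) fun s hs => ?_).trans (by simp)
      exact hsep _ (by omega) (by have := mem_range.1 hs; omega)
    nlinarith
  rw [sum_add_distrib] at h3
  have h1' : _ ≤ ∑ s ∈ range K, (f s).card := h1
  have h2' : _ ≤ ∑ s ∈ range K, (l s).card := h2
  omega

end Distinct

section Expansion

variable {n x y z : ℕ}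

theorem sgn_not (b : Bool) : sgn (!b) = -sgn b := by
  cases b <;> simp [sgn]

theorem abs_sgn (b : Bool) : |sgn b| = 1 := by
  cases b <;> simp [sgn]

theorem Ex_prod_sgn_le_one {ι : Type*} (S : Finset ι) (m : ι → Sym2 (Fin n)) :
    Ex (fun g => ∏ i ∈ S, sgn (g (m i))) ≤ 1 := by
  unfold Ex
  rw [div_le_one (by positivity)]
  refine (sum_le_card_nsmul _ _ 1 fun g _ => ?_).trans (by simp)
  refine (le_abs_self _).trans ?_
  rw [abs_prod]
  simp [abs_sgn]

theorem Ex_prod_sgn_eq_zero {ι : Type*} [DecidableEq ι] (S : Finset ι) (m : ι → Sym2 (Fin n))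
    (i : ι) (hi : i ∈ S) (hm : ∀ j ∈ S, j ≠ i → m j ≠ m i) :
    Ex (fun g => ∏ j ∈ S, sgn (g (m j))) = 0 := by
  unfold Ex
  suffices h : ∑ g : Sym2 (Fin n) → Bool, ∏ j ∈ S, sgn (g (m j)) = 0 by rw [h, zero_div]
  let flip : (Sym2 (Fin n) → Bool) → Sym2 (Fin n) → Bool := fun g =>
    Function.update g (m i) (!g (m i))
  have hflip : Function.Involutive flip := by
    intro g
    simp [flip]
  have key : ∀ g, ∏ j ∈ S, sgn (flip g (m j)) = -∏ j ∈ S, sgn (g (m j)) := by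
    intro g
    rw [← mul_prod_erase S _ hi, ← mul_prod_erase S (fun j => sgn (g (m j))) hi, ← neg_mul]
    congr 1
    · simp [flip, sgn_not]
    · refine prod_congr rfl fun j hj => ?_
      rw [mem_erase] at hj
      simp [flip, Function.update_of_ne (hm j hj.2 hj.1)]
  have h := Equiv.sum_comp hflip.toPerm fun g => ∏ j ∈ S, sgn (g (m j))
  simp only [Function.Involutive.coe_toPerm, key, sum_neg_distrib] at h
  linarith

theorem Ex_sum {ι : Type*} (S : Finset ι) (f : ι → (Sym2 (Fin n) → Bool) → ℝ) :
    Ex (fun g => ∑ i ∈ S, f i g) = ∑ i ∈ S, Ex (f i) := by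
  unfold Ex
  rw [sum_comm, sum_div]

/-- The vertex map `π` determined by the row index, the column index and the inner vertices. -/
def vertexMap (T : SubsetsCard n x × SubsetsCard n y × (Fin z ↪ Fin n)) :
    (Fin x ⊕ Fin y ⊕ Fin z) → Fin n :=
  Sum.elim (tup T.1) (Sum.elim (tup T.2.1) ⇑T.2.2)

theorem tup_injective : Function.Injective (tup : SubsetsCard n x → Fin x → Fin n) := by
  intro A B h
  have key : ∀ C : SubsetsCard n x, (C.1 : Set (Fin n)) = Set.range (tup C) := by
    intro C
    ext v
    simp only [mem_coe, Set.mem_range, tup]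
    constructor
    · intro hv
      exact ⟨(C.1.orderIsoOfFin C.2).symm ⟨v, hv⟩, by simp⟩
    · rintro ⟨i, rfl⟩
      exact (C.1.orderIsoOfFin C.2 i).2
  apply Subtype.ext
  rw [← coe_inj, key, key, h]

/-- The conditions under which a triple contributes to an entry of the matrix. -/
def IsAdmissible (P : (Fin x ⊕ Fin y ⊕ Fin z) → Finset (Fin n))
    (T : SubsetsCard n x × SubsetsCard n y × (Fin z ↪ Fin n)) : Prop :=
  (Disjoint T.1.1 T.2.1.1 ∧ ∀ m, T.2.2 m ∉ T.1.1 ∧ T.2.2 m ∉ T.2.1.1) ∧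
    ∀ a, vertexMap T a ∈ P a

open Classical in
/-- The contribution of a triple to an entry of the matrix. -/
noncomputable def entryTerm (H : SimpleGraph (Fin x ⊕ Fin y ⊕ Fin z)) [DecidableRel H.Adj]
    (P : (Fin x ⊕ Fin y ⊕ Fin z) → Finset (Fin n)) (g : Sym2 (Fin n) → Bool)
    (T : SubsetsCard n x × SubsetsCard n y × (Fin z ↪ Fin n)) : ℝ :=
  if IsAdmissible P T then ∏ e ∈ H.edgeFinset, sgn (g (Sym2.map (vertexMap T) e)) else 0

theorem RHgenPart_apply (H : SimpleGraph (Fin x ⊕ Fin y ⊕ Fin z)) [DecidableRel H.Adj]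
    (P : (Fin x ⊕ Fin y ⊕ Fin z) → Finset (Fin n)) (g : Sym2 (Fin n) → Bool)
    (A : SubsetsCard n x) (B : SubsetsCard n y) :
    RHgenPart H P g A B = ∑ C, entryTerm H P g (A, B, C) := by
  classical
  simp only [RHgenPart, Matrix.of_apply, entryTerm]
  have hiff : ∀ C : Fin z ↪ Fin n, IsAdmissible P (A, B, C) ↔
      (Disjoint A.1 B.1 ∧ (∀ i, tup A i ∈ P (Sum.inl i)) ∧
        (∀ j, tup B j ∈ P (Sum.inr (Sum.inl j)))) ∧
      ((∀ m, C m ∉ A.1 ∧ C m ∉ B.1) ∧ ∀ m, C m ∈ P (Sum.inr (Sum.inr m))) := by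
    intro C
    simp only [IsAdmissible, vertexMap, Sum.forall, Sum.elim_inl, Sum.elim_inr]
    tauto
  simp only [hiff]
  by_cases h : Disjoint A.1 B.1 ∧ (∀ i, tup A i ∈ P (Sum.inl i)) ∧
      (∀ j, tup B j ∈ P (Sum.inr (Sum.inl j)))
  · simp only [h, true_and, if_true, implies_true, vertexMap]
  · simp only [h, false_and, if_false, sum_const_zero]

theorem Ex_prod_entryTerm_le (H : SimpleGraph (Fin x ⊕ Fin y ⊕ Fin z)) [DecidableRel H.Adj]
    (P : (Fin x ⊕ Fin y ⊕ Fin z) → Finset (Fin n))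
    (hP : ∀ a b, a ≠ b → Disjoint (P a) (P b)) (K : ℕ)
    (T : ℕ → SubsetsCard n x × SubsetsCard n y × (Fin z ↪ Fin n))
    [Decidable (EdgesRepeat H K fun s => vertexMap (T s))] :
    Ex (fun g => ∏ s ∈ range K, entryTerm H P g (T s)) ≤
      if EdgesRepeat H K fun s => vertexMap (T s) then 1 else 0 := by
  classical
  by_cases hadm : ∀ s < K, IsAdmissible P (T s)
  swap
  · push Not at hadm
    obtain ⟨s, hs, hT⟩ := hadm
    have : ∀ g, ∏ s ∈ range K, entryTerm H P g (T s) = 0 := fun g =>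
      prod_eq_zero (mem_range.2 hs) (by simp [entryTerm, hT])
    simp only [this]
    simp only [Ex, sum_const_zero, zero_div]
    split_ifs <;> norm_num
  have hprod : ∀ g, ∏ s ∈ range K, entryTerm H P g (T s) =
      ∏ p ∈ range K ×ˢ H.edgeFinset, sgn (g (Sym2.map (vertexMap (T p.1)) p.2)) := by
    intro g
    rw [prod_product]
    refine prod_congr rfl fun s hs => ?_
    rw [entryTerm, if_pos (hadm s (mem_range.1 hs))]
  simp only [hprod]
  split_ifs with hrep
  · exact Ex_prod_sgn_le_one _ fun p : ℕ × _ => Sym2.map (vertexMap (T p.1)) p.2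
  refine le_of_eq ?_
  have hinj : ∀ s < K, ∀ s' < K, ∀ a b, vertexMap (T s) a = vertexMap (T s') b → a = b := by
    intro s hs s' hs' a b h
    by_contra hne
    exact disjoint_left.1 (hP a b hne) ((hadm s hs).2 a) (h ▸ (hadm s' hs').2 b)
  unfold EdgesRepeat at hrep
  push Not at hrep
  obtain ⟨s, hs, a, b, hab, hnot⟩ := hrep
  refine Ex_prod_sgn_eq_zero _ (fun p : ℕ × _ => Sym2.map (vertexMap (T p.1)) p.2)
    (s, s(a, b)) (by simp [hs, hab]) ?_
  rintro ⟨s', e⟩ hmem hne heq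
  simp only [mem_product, mem_range] at hmem
  have hs' := hmem.1
  induction e using Sym2.ind with
  | _ c d =>
  simp only [Sym2.map_mk, Sym2.eq_iff] at heq
  have : s(c, d) = s(a, b) ∧ vertexMap (T s') a = vertexMap (T s) a ∧
      vertexMap (T s') b = vertexMap (T s) b := by
    rcases heq with ⟨h1, h2⟩ | ⟨h1, h2⟩
    · obtain rfl := hinj _ hs' _ hs _ _ h1
      obtain rfl := hinj _ hs' _ hs _ _ h2
      exact ⟨rfl, h1, h2⟩
    · obtain rfl := hinj _ hs' _ hs _ _ h1
      obtain rfl := hinj _ hs' _ hs _ _ h2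
      exact ⟨Sym2.eq_swap, h2, h1⟩
  have hss : s' ≠ s := by
    rintro rfl
    exact hne (by rw [this.1])
  exact hnot s' hs' hss this.2.1 this.2.2

/-- The summation variables of the expanded trace: the row indices, and between consecutive rows
a column index with the inner vertices of the two adjacent copies. -/
abbrev Config (n x y z k : ℕ) :=
  (Fin (k + 1) → SubsetsCard n x) ×
    (Fin (k + 1) → SubsetsCard n y × (Fin z ↪ Fin n) × (Fin z ↪ Fin n))

/-- The triple used by the `s`-th copy of the graph. -/
def Config.copy {k : ℕ} (c : Config n x y z k) (s : ℕ) :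
    SubsetsCard n x × SubsetsCard n y × (Fin z ↪ Fin n) :=
  let i := Fin.ofNat (k + 1) (s / 2)
  if s % 2 = 0 then (c.1 i, (c.2 i).1, (c.2 i).2.1)
  else (c.1 (i + 1), (c.2 i).1, (c.2 i).2.2)

theorem Config.copy_even {k : ℕ} (c : Config n x y z k) (i : ℕ) :
    c.copy (2 * i) = (c.1 (Fin.ofNat (k + 1) i), (c.2 (Fin.ofNat (k + 1) i)).1,
      (c.2 (Fin.ofNat (k + 1) i)).2.1) := by
  simp [Config.copy]

theorem Config.copy_odd {k : ℕ} (c : Config n x y z k) (i : ℕ) :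
    c.copy (2 * i + 1) = (c.1 (Fin.ofNat (k + 1) i + 1), (c.2 (Fin.ofNat (k + 1) i)).1,
      (c.2 (Fin.ofNat (k + 1) i)).2.2) := by
  simp [Config.copy, Nat.add_mod, show (2 * i + 1) / 2 = i by omega]

theorem prod_range_two_mul {M : Type*} [CommMonoid M] (f : ℕ → M) (m : ℕ) :
    ∏ s ∈ range (2 * m), f s = ∏ i ∈ range m, f (2 * i) * f (2 * i + 1) := by
  induction m with
  | zero => simp
  | succ m ih =>
    rw [show 2 * (m + 1) = 2 * m + 1 + 1 by ring, prod_range_succ, prod_range_succ, ih,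
      prod_range_succ, mul_assoc]

theorem trace_eq_sum_config (H : SimpleGraph (Fin x ⊕ Fin y ⊕ Fin z)) [DecidableRel H.Adj]
    (P : (Fin x ⊕ Fin y ⊕ Fin z) → Finset (Fin n)) (k : ℕ) (g : Sym2 (Fin n) → Bool) :
    ((RHgenPart H P g * (RHgenPart H P g).transpose) ^ (k + 1)).trace =
      ∑ c : Config n x y z k, ∏ s ∈ range (2 * (k + 1)), entryTerm H P g (c.copy s) := by
  rw [Matrix.trace_pow_succ_eq_sum, Fintype.sum_prod_type]
  refine sum_congr rfl fun A _ => ?_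
  have hM : ∀ A A', (RHgenPart H P g * (RHgenPart H P g).transpose) A A' =
      ∑ d : SubsetsCard n y × (Fin z ↪ Fin n) × (Fin z ↪ Fin n),
        entryTerm H P g (A, d.1, d.2.1) * entryTerm H P g (A', d.1, d.2.2) := by
    intro A A'
    simp only [Matrix.mul_apply, Matrix.transpose_apply, RHgenPart_apply, Fintype.sum_prod_type,
      sum_mul_sum]
  simp only [hM]
  rw [Fintype.prod_sum]
  refine sum_congr rfl fun D _ => ?_
  rw [prod_range_two_mul, ← Fin.prod_univ_eq_prod_range
    (fun i => entryTerm H P g (Config.copy (A, D) (2 * i)) *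
      entryTerm H P g (Config.copy (A, D) (2 * i + 1)))]
  refine prod_congr rfl fun i _ => ?_
  rw [Config.copy_even, Config.copy_odd]
  simp

/-- The values of a configuration, listed along the `(x + y + 2z)(k + 1)` positions. -/
def Config.values {k : ℕ} (c : Config n x y z k) :
    Fin (k + 1) × (Fin x ⊕ Fin y ⊕ Fin z ⊕ Fin z) → Fin n := fun p =>
  Sum.elim (tup (c.1 p.1)) (Sum.elim (tup (c.2 p.1).1)
    (Sum.elim ⇑(c.2 p.1).2.1 ⇑(c.2 p.1).2.2)) p.2

theorem Config.values_injective {k : ℕ} :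
    Function.Injective (Config.values : Config n x y z k → _) := by
  rintro ⟨A, D⟩ ⟨A', D'⟩ h
  have h' : ∀ i p, _ := fun i p => congrFun h (i, p)
  have hA : A = A' := by
    funext i
    exact tup_injective (funext fun j => h' i (Sum.inl j))
  have hD : D = D' := by
    funext i
    refine Prod.ext (tup_injective (funext fun j => h' i (Sum.inr (Sum.inl j)))) (Prod.ext ?_ ?_)
    · exact DFunLike.ext _ _ fun j => h' i (Sum.inr (Sum.inr (Sum.inl j)))
    · exact DFunLike.ext _ _ fun j => h' i (Sum.inr (Sum.inr (Sum.inr j)))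
  rw [hA, hD]

theorem Config.image_values_subset {k : ℕ} (c : Config n x y z k) :
    univ.image c.values ⊆
      (range (2 * (k + 1)) ×ˢ (univ : Finset (Fin x ⊕ Fin y ⊕ Fin z))).image
        fun p => vertexMap (c.copy p.1) p.2 := by
  intro v hv
  obtain ⟨⟨i, p⟩, -, rfl⟩ := mem_image.1 hv
  have he := c.copy_even i
  have ho := c.copy_odd i
  have hi := i.2
  simp only [Fin.ofNat_eq_cast, Fin.cast_val_eq_self] at he ho
  simp only [mem_image, mem_product, mem_range, mem_univ, and_true, Prod.exists]
  rcases p with j | j | j | j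
  · exact ⟨2 * i, Sum.inl j, by omega, by rw [he]; rfl⟩
  · exact ⟨2 * i, Sum.inr (Sum.inl j), by omega, by rw [he]; rfl⟩
  · exact ⟨2 * i, Sum.inr (Sum.inr j), by omega, by rw [he]; rfl⟩
  · exact ⟨2 * i + 1, Sum.inr (Sum.inr j), by omega, by rw [ho]; rfl⟩

theorem Config.card_image_values_le {q k : ℕ} (H : SimpleGraph (Fin x ⊕ Fin y ⊕ Fin z))
    [DecidableRel H.Adj] (hdeg : ∀ m : Fin z, 0 < H.degree (Sum.inr (Sum.inr m)))
    (hq : ∀ S, IsSep H S → q ≤ S.card) (c : Config n x y z k)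
    (hc : EdgesRepeat H (2 * (k + 1)) fun s => vertexMap (c.copy s)) :
    (univ.image c.values).card ≤ (x + y + z - q) * k + (x + y + z) := by
  refine (card_le_card c.image_values_subset).trans
    (card_image_le_of_edgesRepeat k H hdeg hq _ hc ?_ ?_ ?_)
  · intro i _ j
    rw [c.copy_even, c.copy_odd]
    rfl
  · intro i hi j
    have hsucc : Fin.ofNat (k + 1) (i + 1) = Fin.ofNat (k + 1) i + 1 := by
      apply Fin.ext
      simp [Fin.val_add]
    rw [show 2 * i + 2 = 2 * (i + 1) by ring, c.copy_even, c.copy_odd, hsucc]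
    rfl
  · intro j
    rw [show 0 = 2 * 0 by rfl, c.copy_even, c.copy_odd]
    simp [vertexMap]

theorem card_config_le {q : ℕ} (k : ℕ) (H : SimpleGraph (Fin x ⊕ Fin y ⊕ Fin z))
    [DecidableRel H.Adj] (hdeg : ∀ m : Fin z, 0 < H.degree (Sum.inr (Sum.inr m)))
    (hq : ∀ S, IsSep H S → q ≤ S.card) (hqx : q ≤ x)
    [DecidablePred fun c : Config n x y z k =>
      EdgesRepeat H (2 * (k + 1)) fun s => vertexMap (c.copy s)] :
    (univ.filter fun c : Config n x y z k =>
      EdgesRepeat H (2 * (k + 1)) fun s => vertexMap (c.copy s)).card ≤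
      ((x + y + 2 * z) * (k + 1)) ^ (2 * (k + 1) * (z + q) - 2 * q) *
        n ^ ((x + y + z - q) * (k + 1) + q) := by
  classical
  rw [← card_image_of_injective _ Config.values_injective]
  obtain ⟨w, rfl⟩ := Nat.exists_eq_add_of_le hqx
  have hsub : q + w + y + z - q = w + y + z := by omega
  have h := card_le_of_card_image_le
    ((univ.filter fun c : Config n (q + w) y z k =>
      EdgesRepeat H (2 * (k + 1)) fun s => vertexMap (c.copy s)).image Config.values)
    ((w + y + z) * (k + 1) + q) (z * (k + 1) + q * k)
    (by simp only [Fintype.card_prod, Fintype.card_sum, Fintype.card_fin]; ring) (by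
      intro f hf
      obtain ⟨c, hc, rfl⟩ := mem_image.1 hf
      refine (c.card_image_values_le H hdeg hq (mem_filter.1 hc).2).trans (le_of_eq ?_)
      rw [hsub]; ring)
  refine h.trans (le_of_eq ?_)
  have hexp : 2 * (k + 1) * (z + q) - 2 * q = 2 * (z * (k + 1) + q * k) := by
    rw [show 2 * (k + 1) * (z + q) = 2 * (z * (k + 1) + q * k) + 2 * q by ring]
    omega
  rw [hsub, hexp]
  simp only [Fintype.card_prod, Fintype.card_sum, Fintype.card_fin]
  congr 2
  ring

end Expansion

end

theorem stmt16 (n x y z q k : ℕ) (hn : 1 ≤ n) (hk : 1 ≤ k)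
    (H : SimpleGraph (Fin x ⊕ Fin y ⊕ Fin z)) [DecidableRel H.Adj]
    (hdeg : ∀ m : Fin z, 0 < H.degree (Sum.inr (Sum.inr m)))
    (hq : IsLeast {m | ∃ S, IsSep H S ∧ S.card = m} q)
    (P : (Fin x ⊕ Fin y ⊕ Fin z) → Finset (Fin n))
    (hPdisj : ∀ a b, a ≠ b → Disjoint (P a) (P b))
    (hPcov : ∀ v : Fin n, ∃ a, v ∈ P a) :
    Ex (fun g => Matrix.trace ((RHgenPart H P g * (RHgenPart H P g).transpose) ^ k))
      ≤ ((((x + y + 2 * z) * k) ^ (2 * k * (z + q) - 2 * q)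
            * n ^ ((x + y + z - q) * k + q) : ℕ) : ℝ) := by
  classical
  obtain ⟨k, rfl⟩ : ∃ j, k = j + 1 := ⟨k - 1, by omega⟩
  have hmin : ∀ S, IsSep H S → q ≤ S.card := fun S hS => hq.2 ⟨S, hS, rfl⟩
  have hqx : q ≤ x := by
    have hU : IsSep H (Finset.univ.image Sum.inl) := fun i j p =>
      ⟨Sum.inl i, Finset.mem_image_of_mem _ (Finset.mem_univ i), p.start_mem_support⟩
    exact (hmin _ hU).trans (Finset.card_image_le.trans (by simp))
  simp only [trace_eq_sum_config]
  rw [Ex_sum]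
  refine (Finset.sum_le_sum fun c _ => Ex_prod_entryTerm_le H P hPdisj _ c.copy).trans ?_
  rw [Finset.sum_boole]
  exact_mod_cast card_config_le k H hdeg hmin hqx
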